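/- Let k be a field of characteristic p > 0 and K = k(x,y). Let m_x, m_y ∈ ℕ and consider the derivation ∂ = y^{m_y}·∂_x + x^{m_x}·∂_y of K. Then ∂ is p-closed (there exists a ∈ K with ∂^p = a·∂) if and only if p ∤ (m_x + 1) and p ∤ (m_y + 1). -/

import Mathlib

open MvPolynomial

noncomputable section

/-- The rational function field `k(x,y)`, realized as the fraction field of `k[x,y]`. -/
abbrev RatFld2 (k : Type) [Field k] : Type := FractionRing (MvPolynomial (Fin 2) k)

/-- The image of the indeterminate `x` in `k(x,y)`. -/
abbrev xK (k : Type) [Field k] : RatFld2 k :=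
  algebraMap (MvPolynomial (Fin 2) k) (RatFld2 k) (X 0)

/-- The image of the indeterminate `y` in `k(x,y)`. -/
abbrev yK (k : Type) [Field k] : RatFld2 k :=
  algebraMap (MvPolynomial (Fin 2) k) (RatFld2 k) (X 1)

open Finset in
/-- The iterated Leibniz rule for derivations of commutative algebras. -/
theorem Derivation.iterate_mul_eq_sum {R A : Type*} [CommRing R] [CommRing A] [Algebra R A]
    (D : Derivation R A A) (n : ℕ) (a b : A) :
    D^[n] (a * b) =
      ∑ ij ∈ antidiagonal n, (n.choose ij.1 : A) * (D^[ij.1] a * D^[ij.2] b) := by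
  induction n with
  | zero => simp
  | succ n ih =>
    rw [sum_antidiagonal_choose_succ_mul (fun i j => D^[i] a * D^[j] b) n,
      Function.iterate_succ_apply', ih, map_sum, ← sum_add_distrib]
    refine sum_congr rfl fun ij hij => ?_
    rw [Nat.choose_symm_of_eq_add (HasAntidiagonal.mem_antidiagonal.1 hij).symm]
    simp only [Derivation.leibniz, smul_eq_mul, Derivation.map_natCast,
      Function.iterate_succ_apply']
    ring

open Finset in
/-- Modulo a prime `p`, a binomial convolution of length `p` reduces to its two end terms. -/
theorem sum_antidiagonal_choose_prime {A : Type*} [CommRing A] (p : ℕ) (hp : p.Prime) [CharP A p]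
    (f : ℕ → ℕ → A) :
    ∑ ij ∈ antidiagonal p, (p.choose ij.1 : A) * f ij.1 ij.2 = f 0 p + f p 0 := by
  have hne : ((0, p) : ℕ × ℕ) ≠ (p, 0) := fun h => hp.ne_zero (congrArg Prod.snd h)
  rw [← sum_subset (s₁ := {(0, p), (p, 0)}), sum_pair hne]
  · simp
  · intro ij
    simp only [mem_insert, mem_singleton, HasAntidiagonal.mem_antidiagonal]
    rintro (rfl | rfl) <;> simp
  · rintro ⟨i, j⟩ hij hn
    simp only [mem_insert, mem_singleton, Prod.mk.injEq, not_or,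
      HasAntidiagonal.mem_antidiagonal] at hij hn
    rw [(CharP.cast_eq_zero_iff A p _).2 (hp.dvd_choose_self (by lia) (by lia)), zero_mul]

/-- In characteristic `p`, the `p`-fold iterate of a derivation is a derivation. -/
def Derivation.iterateChar {R A : Type*} [CommRing R] [CommRing A] [Algebra R A]
    (p : ℕ) (hp : p.Prime) [CharP A p] (D : Derivation R A A) : Derivation R A A :=
  Derivation.mk' (D.toLinearMap ^ p) fun a b => by
    simp only [Module.End.pow_apply, smul_eq_mul]
    refine (D.iterate_mul_eq_sum p a b).trans ?_
    rw [sum_antidiagonal_choose_prime p hp (fun i j => D^[i] a * D^[j] b)]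
    exact congrArg _ (mul_comm _ _)

theorem Derivation.iterateChar_apply {R A : Type*} [CommRing R] [CommRing A] [Algebra R A]
    (p : ℕ) (hp : p.Prime) [CharP A p] (D : Derivation R A A) (a : A) :
    D.iterateChar p hp a = D^[p] a := by
  simp only [Derivation.iterateChar, Derivation.coe_mk', Module.End.pow_apply]
  rfl

/-- In characteristic `p`, `p`-th powers are constants for every derivation. -/
theorem Derivation.iterate_pow_char_mul {R A : Type*} [CommRing R] [CommRing A] [Algebra R A]
    (p : ℕ) [CharP A p] (D : Derivation R A A) (n : ℕ) (c v : A) :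
    D^[n] (c ^ p * v) = c ^ p * D^[n] v := by
  induction n with
  | zero => rfl
  | succ n ih =>
    rw [Function.iterate_succ_apply', ih, Function.iterate_succ_apply', Derivation.leibniz,
      Derivation.leibniz_pow]
    simp

namespace Polynomial

open Finset
open scoped Differential Polynomial

/-- The polynomial `(∂ + uX)ⁿ(1)`, where `∂` acts on coefficients. -/
def bellPoly {A : Type*} [CommRing A] [Differential A] (u : A) : ℕ → A[X]
  | 0 => 1
  | n + 1 => Differential.mapCoeffs (bellPoly u n) + X * (C u * bellPoly u n)

/-- The sequence whose zeroth term is `0`, followed by the iterated derivatives of `u`. -/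
def shiftedDerivs {A : Type*} [CommRing A] [Differential A] (u : A) : ℕ → A
  | 0 => 0
  | n + 1 => (Differential.deriv : Derivation ℤ A A)^[n] u

theorem derivative_mapCoeffs {A : Type*} [CommRing A] [Differential A] (f : A[X]) :
    derivative (Differential.mapCoeffs f) = Differential.mapCoeffs (derivative f) := by
  ext i
  have h : ((i : A) + 1) = ((i + 1 : ℕ) : A) := by push_cast; rfl
  simp only [coeff_derivative, Differential.coeff_mapCoeffs, h, Derivation.leibniz,
    Derivation.map_natCast, smul_eq_mul, mul_zero, zero_add]
  ring

theorem derivative_bellPoly {A : Type*} [CommRing A] [Differential A] (u : A) (n : ℕ) :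
    derivative (bellPoly u n) = ∑ ij ∈ antidiagonal n,
      (n.choose ij.1 : A[X]) * (C (shiftedDerivs u ij.1) * bellPoly u ij.2) := by
  induction n with
  | zero => simp [bellPoly, shiftedDerivs]
  | succ n ih =>
    rw [sum_antidiagonal_choose_succ_mul
      (fun i j => C (shiftedDerivs u i) * bellPoly u j) n]
    have h1 : ∑ ij ∈ antidiagonal n,
        (n.choose ij.2 : A[X]) * (C (shiftedDerivs u (ij.1 + 1)) * bellPoly u ij.2) =
        C u * bellPoly u n + ∑ ij ∈ antidiagonal n,
          (n.choose ij.1 : A[X]) *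
            (C (Differential.deriv (shiftedDerivs u ij.1) : A) * bellPoly u ij.2) := by
      have h2 : C u * bellPoly u n = ∑ ij ∈ antidiagonal n,
          if ij = (0, n) then C u * bellPoly u n else 0 := by simp
      rw [h2, ← sum_add_distrib]
      refine sum_congr rfl fun ij hij => ?_
      rw [Nat.choose_symm_of_eq_add (HasAntidiagonal.mem_antidiagonal.1 hij).symm]
      obtain ⟨i, j⟩ := ij
      cases i with
      | zero =>
        obtain rfl : j = n := by simpa using hij
        simp [shiftedDerivs]
      | succ i => simp [shiftedDerivs, Function.iterate_succ_apply']
    rw [h1]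
    have h3 : Differential.mapCoeffs (derivative (bellPoly u n)) +
        X * (C u * derivative (bellPoly u n)) =
        ∑ ij ∈ antidiagonal n,
          (n.choose ij.1 : A[X]) * (C (shiftedDerivs u ij.1) * bellPoly u (ij.2 + 1)) +
        ∑ ij ∈ antidiagonal n, (n.choose ij.1 : A[X]) *
          (C (Differential.deriv (shiftedDerivs u ij.1) : A) * bellPoly u ij.2) := by
      rw [ih, map_sum, mul_sum, mul_sum, ← sum_add_distrib, ← sum_add_distrib]
      refine sum_congr rfl fun ij _ => ?_
      simp only [bellPoly, Derivation.leibniz, Derivation.map_natCast,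
        Differential.mapCoeffs_C, smul_eq_mul]
      ring
    rw [bellPoly, derivative_add, derivative_mapCoeffs, derivative_mul, derivative_C_mul,
      derivative_X, one_mul, add_left_comm, h3, add_left_comm]

theorem coeff_bellPoly {A : Type*} [CommRing A] [Differential A] (u : A) (n : ℕ) :
    (bellPoly u n).coeff n = u ^ n ∧ ∀ m, n < m → (bellPoly u n).coeff m = 0 := by
  induction n with
  | zero => simp +contextual [bellPoly, coeff_one, Nat.pos_iff_ne_zero]
  | succ n ih =>
    refine ⟨?_, fun m hm => ?_⟩
    · simp [bellPoly, coeff_X_mul, ih.1, ih.2, pow_succ']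
    · obtain ⟨m, rfl⟩ := Nat.exists_eq_succ_of_ne_zero (show m ≠ 0 by lia)
      simp [bellPoly, coeff_X_mul, ih.2 m (by lia), ih.2 (m + 1) (by lia)]

theorem coeff_zero_bellPoly_succ {A : Type*} [CommRing A] [Differential A] (u : A) (n : ℕ) :
    (bellPoly u (n + 1)).coeff 0 = 0 := by
  induction n with
  | zero => simp [bellPoly]
  | succ n ih => rw [bellPoly]; simp [ih]

theorem bellPoly_prime {K : Type*} [Field K] [Differential K] (p : ℕ) (hp : p.Prime) [CharP K p]
    (u : K) :
    bellPoly u p = C (u ^ p) * X ^ p +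
      C ((Differential.deriv : Derivation ℤ K K)^[p - 1] u) * X := by
  obtain ⟨q, rfl⟩ := Nat.exists_eq_succ_of_ne_zero hp.ne_zero
  simp only [Nat.succ_eq_add_one, Nat.add_sub_cancel] at *
  have hd := derivative_bellPoly u (q + 1)
  rw [sum_antidiagonal_choose_prime (q + 1) hp
    (fun i j => C (shiftedDerivs u i) * bellPoly u j)] at hd
  simp only [shiftedDerivs, C_0, zero_mul, zero_add] at hd
  rw [show bellPoly u 0 = 1 from rfl, mul_one] at hd
  have hq : 0 < q := by have := hp.two_le; lia
  ext i
  rcases Nat.eq_zero_or_pos i with rfl | hi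
  · simp [coeff_zero_bellPoly_succ]
  obtain ⟨i, rfl⟩ := Nat.exists_eq_succ_of_ne_zero hi.ne'
  rcases lt_trichotomy i q with h | rfl | h
  · have hc := congrArg (fun f => coeff f i) hd
    simp only [coeff_derivative, coeff_C] at hc
    have hi0 : ((i : K) + 1) ≠ 0 := by
      intro h0
      have : ((i + 1 : ℕ) : K) = 0 := by push_cast; exact h0
      have := Nat.le_of_dvd (by lia) ((CharP.cast_eq_zero_iff K (q + 1) _).1 this)
      lia
    apply mul_right_cancel₀ hi0
    rw [hc]
    rcases Nat.eq_zero_or_pos i with rfl | hi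
    · simp [-map_pow, coeff_X_pow, hq.ne']
    · simp [-map_pow, coeff_X_pow, coeff_C, hi.ne', h.ne]
  · simp [(coeff_bellPoly u (i + 1)).1, -map_pow, coeff_C, hq.ne']
  · simp [(coeff_bellPoly u (q + 1)).2 (i + 1) (by lia), -map_pow, coeff_X_pow,
      coeff_C, h.ne', (hq.trans h).ne']

theorem iterate_deriv_eq_mul_eval_bellPoly {K : Type*} [Field K] [Differential K] (x : K)
    (hx : x ≠ 0) (n : ℕ) :
    (Differential.deriv : Derivation ℤ K K)^[n] x = x * (bellPoly (x′ / x) n).eval 1 := by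
  induction n with
  | zero => simp [bellPoly]
  | succ n ih =>
    have h : ((bellPoly (x′ / x) n).eval 1)′ =
        (Differential.mapCoeffs (bellPoly (x′ / x) n)).eval 1 := by
      have : DifferentialAlgebra K K := ⟨fun _ => rfl⟩
      simpa [coe_aeval_eq_eval] using Differential.deriv_aeval_eq (1 : K) (bellPoly (x′ / x) n)
    rw [Function.iterate_succ_apply', ih, Derivation.leibniz, h]
    simp only [bellPoly, eval_add, eval_mul, eval_X, eval_C, smul_eq_mul]
    field_simp

end Polynomial

/-- Jacobson's formula for the `p`-fold iterate of a derivation, in logarithmic form. -/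
theorem Derivation.iterate_char_eq {R K : Type*} [CommRing R] [Field K] [Algebra R K]
    (p : ℕ) (hp : p.Prime) [CharP K p] (D : Derivation R K K) (x : K) (hx : x ≠ 0) :
    D^[p] x = x * ((D x / x) ^ p + D^[p - 1] (D x / x)) := by
  let _ : Differential K := ⟨D.restrictScalars ℤ⟩
  have h := Polynomial.iterate_deriv_eq_mul_eval_bellPoly x hx p
  rw [Polynomial.bellPoly_prime p hp] at h
  simp only [Polynomial.eval_add, Polynomial.eval_mul, Polynomial.eval_C, Polynomial.eval_pow,
    Polynomial.eval_X, one_pow, mul_one] at h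
  exact h

/-- The action of the `p`-fold iterate of a derivation on the form `xⁿ dx`, when `p ∤ n + 1`. -/
theorem Derivation.pow_mul_iterate_char_of_not_dvd {R K : Type*} [CommRing R] [Field K]
    [Algebra R K] (p : ℕ) (hp : p.Prime) [CharP K p] (D : Derivation R K K) (x : K) (n : ℕ)
    (hn : ¬ p ∣ n + 1) :
    x ^ n * D^[p] x = D^[p - 1] (x ^ n * D x) := by
  have hn0 : ((n + 1 : ℕ) : K) ≠ 0 := fun h => hn ((CharP.cast_eq_zero_iff K p _).1 h)
  have hmul (m : ℕ) (c : ℕ) (v : K) : D^[m] (c * v) = c * D^[m] v := by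
    induction m with
    | zero => rfl
    | succ m ih => simp [Function.iterate_succ_apply', ih]
  have h := (D.iterateChar p hp).leibniz_pow x (n + 1)
  simp only [Derivation.iterateChar_apply, Nat.add_sub_cancel, smul_eq_mul, nsmul_eq_mul] at h
  obtain ⟨q, rfl⟩ := Nat.exists_eq_succ_of_ne_zero hp.ne_zero
  rw [Function.iterate_succ_apply, D.leibniz_pow] at h
  simp only [Nat.add_sub_cancel, smul_eq_mul, nsmul_eq_mul, hmul] at h
  exact (mul_left_cancel₀ hn0 h).symm

/-- The action of the `p`-fold iterate of a derivation on the form `xⁿ dx`, when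
`n + 1 = p (c + 1)`. -/
theorem Derivation.pow_mul_iterate_char_of_eq {R K : Type*} [CommRing R] [Field K]
    [Algebra R K] (p : ℕ) (hp : p.Prime) [CharP K p] (D : Derivation R K K) (x : K) (hx : x ≠ 0)
    (n c : ℕ) (hn : n + 1 = p * (c + 1)) :
    x ^ n * D^[p] x = D^[p - 1] (x ^ n * D x) + (x ^ c * D x) ^ p := by
  have h (v : K) : (x ^ (c + 1)) ^ p * (v / x) = x ^ n * v := by
    rw [← pow_mul, mul_comm (c + 1), ← hn, pow_succ]
    field_simp
  rw [D.iterate_char_eq p hp x hx, ← h (D x), D.iterate_pow_char_mul p, add_comm, mul_add,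
    mul_add, ← mul_assoc, ← mul_assoc, ← pow_succ, hn, mul_comm p, pow_mul, ← mul_pow]
  congr 2
  field_simp
  ring

/-- Derivations of `k(x,y)` over `k` are determined by their values at `x` and `y`. -/
theorem RatFld2.derivation_ext {k : Type} [Field k]
    {D E : Derivation k (RatFld2 k) (RatFld2 k)} (hx : D (xK k) = E (xK k))
    (hy : D (yK k) = E (yK k)) : D = E := by
  have h : D.compAlgebraMap (MvPolynomial (Fin 2) k) = E.compAlgebraMap _ := by
    apply MvPolynomial.derivation_ext
    intro i
    fin_cases i
    · exact hx
    · exact hy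
  have h' (f : MvPolynomial (Fin 2) k) : D (algebraMap _ _ f) = E (algebraMap _ _ f) :=
    Derivation.congr_fun h f
  ext z
  obtain ⟨f, g, -, rfl⟩ := IsFractionRing.div_surjective (A := MvPolynomial (Fin 2) k) z
  rw [Derivation.leibniz_div, Derivation.leibniz_div, h', h']

theorem RatFld2.xK_pow_mul_yK_pow_injective {k : Type} [Field k] {a b c d : ℕ}
    (h : xK k ^ a * yK k ^ b = xK k ^ c * yK k ^ d) : a = c ∧ b = d := by
  simp only [xK, yK, ← map_pow, ← map_mul] at h
  have h := IsFractionRing.injective (MvPolynomial (Fin 2) k) (RatFld2 k) h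
  simp only [X_pow_eq_monomial, monomial_mul, mul_one] at h
  have h := monomial_left_injective one_ne_zero h
  have h0 := DFunLike.congr_fun h 0
  have h1 := DFunLike.congr_fun h 1
  simp at h0 h1
  exact ⟨h0, h1⟩

theorem RatFld2.xK_ne_zero {k : Type} [Field k] : xK k ≠ 0 := by simp [xK]

theorem RatFld2.yK_ne_zero {k : Type} [Field k] : yK k ≠ 0 := by simp [yK]

/-- Natural-exponent case of Corollary 4: for `m_x, m_y ∈ ℕ` and
`∂ = y^{m_y}·∂_x + x^{m_x}·∂_y` on `K = k(x,y)`, the derivation `∂` is `p`-closed iff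
`p ∤ (m_x + 1)` and `p ∤ (m_y + 1)`. -/
theorem monomial_derivation_p_closed_iff_nat
    (p : ℕ) (hp : p.Prime) (k : Type) [Field k] [CharP k p]
    (Dx Dy : Derivation k (RatFld2 k) (RatFld2 k))
    (hDxx : Dx (xK k) = 1) (hDxy : Dx (yK k) = 0)
    (hDyx : Dy (xK k) = 0) (hDyy : Dy (yK k) = 1)
    (mx my : ℕ) :
    (∃ a : RatFld2 k, ∀ z,
        (⇑((yK k ^ my) • Dx + (xK k ^ mx) • Dy))^[p] z
          = a * ((yK k ^ my) • Dx + (xK k ^ mx) • Dy) z)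
      ↔ (¬ p ∣ (mx + 1) ∧ ¬ p ∣ (my + 1)) := by
  have : CharP (RatFld2 k) p := charP_of_injective_algebraMap (algebraMap k (RatFld2 k)).injective p
  have hx0 := RatFld2.xK_ne_zero (k := k)
  have hy0 := RatFld2.yK_ne_zero (k := k)
  set D := (yK k ^ my) • Dx + (xK k ^ mx) • Dy with hD
  have hDx : D (xK k) = yK k ^ my := by
    simp only [hD, Derivation.add_apply, Derivation.smul_apply, hDxx, hDyx, smul_eq_mul]; ring
  have hDy : D (yK k) = xK k ^ mx := by
    simp only [hD, Derivation.add_apply, Derivation.smul_apply, hDxy, hDyy, smul_eq_mul]; ring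
  clear_value D
  have hxy : yK k ^ my * xK k ^ mx = xK k ^ mx * yK k ^ my := mul_comm _ _
  have hcases (n : ℕ) (h : p ∣ n + 1) : ∃ c, n + 1 = p * (c + 1) ∧ c < n := by
    obtain ⟨c, hc⟩ := h
    obtain ⟨c, rfl⟩ := Nat.exists_eq_succ_of_ne_zero (show c ≠ 0 by rintro rfl; lia)
    refine ⟨c, hc, ?_⟩
    have := Nat.mul_le_mul_right (c + 1) hp.two_le
    lia
  constructor
  · rintro ⟨a, ha⟩
    have hEq : xK k ^ mx * D^[p] (xK k) = yK k ^ my * D^[p] (yK k) := by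
      rw [ha, ha, hDx, hDy]; ring
    by_cases h1 : p ∣ mx + 1 <;> by_cases h2 : p ∣ my + 1
    · exfalso
      obtain ⟨c, hc, hcn⟩ := hcases _ h1
      obtain ⟨d, hd, hdn⟩ := hcases _ h2
      rw [D.pow_mul_iterate_char_of_eq p hp _ hx0 _ c hc,
        D.pow_mul_iterate_char_of_eq p hp _ hy0 _ d hd, hDx, hDy, hxy, add_right_inj] at hEq
      simp only [mul_comm (yK k ^ d)] at hEq
      rw [mul_pow, mul_pow, ← pow_mul, ← pow_mul, ← pow_mul, ← pow_mul] at hEq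
      have := Nat.eq_of_mul_eq_mul_right hp.pos (RatFld2.xK_pow_mul_yK_pow_injective hEq).1
      lia
    · exfalso
      obtain ⟨c, hc, -⟩ := hcases _ h1
      rw [D.pow_mul_iterate_char_of_eq p hp _ hx0 _ c hc,
        D.pow_mul_iterate_char_of_not_dvd p hp _ _ h2, hDx, hDy, hxy, add_eq_left] at hEq
      exact pow_ne_zero _ (mul_ne_zero (pow_ne_zero _ hx0) (pow_ne_zero _ hy0)) hEq
    · exfalso
      obtain ⟨d, hd, -⟩ := hcases _ h2
      rw [D.pow_mul_iterate_char_of_eq p hp _ hy0 _ d hd,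
        D.pow_mul_iterate_char_of_not_dvd p hp _ _ h1, hDx, hDy, hxy, left_eq_add] at hEq
      exact pow_ne_zero _ (mul_ne_zero (pow_ne_zero _ hy0) (pow_ne_zero _ hx0)) hEq
    · exact ⟨h1, h2⟩
  · rintro ⟨h1, h2⟩
    have hEq : xK k ^ mx * D^[p] (xK k) = yK k ^ my * D^[p] (yK k) := by
      rw [D.pow_mul_iterate_char_of_not_dvd p hp _ _ h1,
        D.pow_mul_iterate_char_of_not_dvd p hp _ _ h2, hDx, hDy, hxy]
    refine ⟨D^[p] (xK k) / yK k ^ my, fun z => ?_⟩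
    have hy0' := pow_ne_zero my hy0
    have hE : D.iterateChar p hp = (D^[p] (xK k) / yK k ^ my) • D := by
      apply RatFld2.derivation_ext
      · rw [Derivation.iterateChar_apply, Derivation.smul_apply, hDx, smul_eq_mul,
          div_mul_cancel₀ _ hy0']
      · rw [Derivation.iterateChar_apply, Derivation.smul_apply, hDy, smul_eq_mul,
          div_mul_eq_mul_div, eq_div_iff hy0', mul_comm, ← hEq, mul_comm]
    rw [← D.iterateChar_apply p hp, hE, Derivation.smul_apply, smul_eq_mul]
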